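/- arXiv:2210.04440 — 10 statements merged into one kernel-verified Lean document; each statement's English description precedes it below -/
import Mathlib

section
/- Let X ⊆ ℝ^n be convex with diameter at most D (i.e. ‖x − x'‖ ≤ D for all x, x' ∈ X), let F be monotone on X, and assume VI_X(F) has a solution x* ∈ X. Fix a real p ≥ 1, L_p > 0, τ ∈ (0,1), and an integer N ≥ 1. Let x^1, …, x^N, x^{1.5}, …, x^{N+0.5}, x^2, …, x^{N+1} ∈ X be ARE iterates, i.e. for each k = 1,…,N, with γ_k := L_p‖x^{k+0.5} − x^k‖^{p−1} > 0 (so x^{k+0.5} ≠ x^k): (i) ⟨F̃_k(x^{k+0.5}) + γ_k(x^{k+0.5} − x^k), x − x^{k+0.5}⟩ ≥ 0 for all x ∈ X, and (ii) ⟨F(x^{k+0.5}) + γ_k(x^{k+1} − x^k), x − x^{k+1}⟩ ≥ 0 for all x ∈ X, where ‖F̃_k(x) − F(x)‖ ≤ τ L_p ‖x − x^k‖^p for all x. Set Γ_N := Σ_{k=1}^N γ_k^{−1} and x̄_N := Γ_N^{−1} Σ_{k=1}^N γ_k^{−1} x^{k+0.5}. Then for every x ∈ X, ⟨F(x), x̄_N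 − x⟩ ≤ D^{p+1} L_p / (2 (1 − τ²)^{(p−1)/2} N^{(p+1)/2}). -/
open scoped InnerProductSpace

theorem are_aux_pow (s r : ℝ) (hs : 0 < s) (hr : 0 ≤ r) : 1 - r * (s - 1) ≤ s ^ (-r) := by
  rw [Real.rpow_def_of_pos hs]
  have h1 := Real.add_one_le_exp (Real.log s * -r)
  have h2 := Real.log_le_sub_one_of_pos hs
  nlinarith

/-- One step of the method. -/
theorem are_aux_step {E : Type*} [NormedAddCommGroup E] [InnerProductSpace ℝ E]
    (a h b z f g : E) (c τ : ℝ) (hc : 0 < c)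
    (h1 : 0 ≤ ⟪g + c • (h - a), b - h⟫_ℝ)
    (h2 : 0 ≤ ⟪f + c • (b - a), z - b⟫_ℝ)
    (h3 : ‖g - f‖ ≤ τ * c * ‖h - a‖) :
    c⁻¹ * ⟪f, h - z⟫_ℝ ≤ (‖a - z‖ ^ 2 - ‖b - z‖ ^ 2 - (1 - τ ^ 2) * ‖h - a‖ ^ 2) / 2 := by
  have h4 : ⟪g - f, b - h⟫_ℝ ≤ τ * c * ‖h - a‖ * ‖b - h‖ :=
    (real_inner_le_norm _ _).trans (mul_le_mul_of_nonneg_right h3 (norm_nonneg _))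
  have h5 : τ * c * ‖h - a‖ * ‖b - h‖ ≤ c * ((τ ^ 2 * ‖h - a‖ ^ 2 + ‖b - h‖ ^ 2) / 2) := by
    nlinarith [mul_nonneg hc.le (sq_nonneg (τ * ‖h - a‖ - ‖b - h‖))]
  rw [inv_mul_le_iff₀ hc]
  have e1 : ⟪g + c • (h - a), b - h⟫_ℝ = ⟪g - f, b - h⟫_ℝ + ⟪f, b - h⟫_ℝ
      + c * ((‖b - a‖ ^ 2 - ‖h - a‖ ^ 2 - ‖b - h‖ ^ 2) / 2) := by
    have : b - a = (h - a) + (b - h) := by abel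
    rw [this, norm_add_sq_real, inner_add_left, inner_smul_left, inner_sub_left g f]
    simp only [conj_trivial]
    ring
  have e2 : ⟪f + c • (b - a), z - b⟫_ℝ = ⟪f, z - b⟫_ℝ
      + c * ((‖a - z‖ ^ 2 - ‖b - z‖ ^ 2 - ‖b - a‖ ^ 2) / 2) := by
    have : z - a = (b - a) + (z - b) := by abel
    rw [norm_sub_rev a z, norm_sub_rev b z, this, norm_add_sq_real, inner_add_left,
      inner_smul_left]
    simp only [conj_trivial]
    ring
  have e4 : ⟪f, h - z⟫_ℝ = - ⟪f, b - h⟫_ℝ - ⟪f, z - b⟫_ℝ := by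
    have e : h - z = - (b - h) - (z - b) := by abel
    rw [e, inner_sub_right, inner_neg_right]
  rw [e4]
  rw [e1] at h1
  rw [e2] at h2
  linarith

/-- Lower bound on the sum of inverse step parameters. -/
theorem are_aux_sum (N : ℕ) (hN : 1 ≤ N) (d : ℕ → ℝ) (r A : ℝ) (hr : 0 ≤ r) (hA : 0 < A)
    (hd : ∀ k ∈ Finset.Icc 1 N, 0 < d k) (hs : ∑ k ∈ Finset.Icc 1 N, d k ^ 2 ≤ A) :
    (N : ℝ) ^ (r + 1) * A ^ (-r) ≤ ∑ k ∈ Finset.Icc 1 N, (d k ^ (2 * r))⁻¹ := by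
  have hN0 : (0 : ℝ) < N := by exact_mod_cast hN
  have hm : 0 < A / N := by positivity
  have key : ∀ k ∈ Finset.Icc 1 N,
      (A / N) ^ (-r) * (1 - r * (d k ^ 2 / (A / N) - 1)) ≤ (d k ^ (2 * r))⁻¹ := by
    intro k hk
    have hdk := hd k hk
    have h := are_aux_pow (d k ^ 2 / (A / N)) r (by positivity) hr
    have e : (d k ^ (2 * r))⁻¹ = (A / N) ^ (-r) * (d k ^ 2 / (A / N)) ^ (-r) := by
      rw [← Real.mul_rpow hm.le (by positivity), mul_div_cancel₀ _ hm.ne', ← Real.rpow_neg hdk.le,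
        ← Real.rpow_natCast, ← Real.rpow_mul hdk.le]
      congr 1
      push_cast
      ring
    rw [e]
    exact mul_le_mul_of_nonneg_left h (by positivity)
  refine le_trans ?_ (Finset.sum_le_sum key)
  rw [← Finset.mul_sum, Finset.sum_sub_distrib, ← Finset.mul_sum, Finset.sum_sub_distrib,
    ← Finset.sum_div]
  simp only [Finset.sum_const, Nat.card_Icc, Nat.add_sub_cancel, nsmul_eq_mul, mul_one]
  have h1 : (∑ k ∈ Finset.Icc 1 N, d k ^ 2) / (A / N) ≤ N := by
    rw [div_le_iff₀ hm, mul_div_cancel₀ _ hN0.ne']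
    exact hs
  have e : (N : ℝ) ^ (r + 1) * A ^ (-r) = (A / N) ^ (-r) * N := by
    rw [Real.div_rpow hA.le hN0.le, Real.rpow_add hN0, Real.rpow_one, Real.rpow_neg hN0.le r]
    field_simp
  rw [e]
  refine mul_le_mul_of_nonneg_left ?_ (by positivity)
  nlinarith

/-- Theorem 3.1 (Global convergence of ARE: Monotone VI). -/
theorem are_global_convergence_monotone
    {n : ℕ} (X : Set (EuclideanSpace ℝ (Fin n))) (hX : Convex ℝ X)
    (D : ℝ) (hD : ∀ x ∈ X, ∀ x' ∈ X, ‖x - x'‖ ≤ D)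
    (F : EuclideanSpace ℝ (Fin n) → EuclideanSpace ℝ (Fin n))
    (hmono : ∀ x ∈ X, ∀ y ∈ X, 0 ≤ ⟪F x - F y, x - y⟫_ℝ)
    (xstar : EuclideanSpace ℝ (Fin n)) (hxstarX : xstar ∈ X)
    (hxstar : ∀ x ∈ X, 0 ≤ ⟪F xstar, x - xstar⟫_ℝ)
    (p Lp τ : ℝ) (hp : 1 ≤ p) (hLp : 0 < Lp) (hτ0 : 0 < τ) (hτ1 : τ < 1)
    (N : ℕ) (hN : 1 ≤ N)
    (x xh : ℕ → EuclideanSpace ℝ (Fin n))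
    (Ftil : ℕ → EuclideanSpace ℝ (Fin n) → EuclideanSpace ℝ (Fin n))
    (hxX : ∀ k ∈ Finset.Icc 1 (N + 1), x k ∈ X)
    (hxhX : ∀ k ∈ Finset.Icc 1 N, xh k ∈ X)
    (γ : ℕ → ℝ) (hγ : ∀ k, γ k = Lp * ‖xh k - x k‖ ^ (p - 1))
    (hγpos : ∀ k ∈ Finset.Icc 1 N, 0 < γ k)
    (hstep1 : ∀ k ∈ Finset.Icc 1 N, ∀ z ∈ X,
      0 ≤ ⟪Ftil k (xh k) + γ k • (xh k - x k), z - xh k⟫_ℝ)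
    (hstep2 : ∀ k ∈ Finset.Icc 1 N, ∀ z ∈ X,
      0 ≤ ⟪F (xh k) + γ k • (x (k + 1) - x k), z - x (k + 1)⟫_ℝ)
    (happrox : ∀ k ∈ Finset.Icc 1 N, ∀ z,
      ‖Ftil k z - F z‖ ≤ τ * Lp * ‖z - x k‖ ^ p)
    (Γ : ℝ) (hΓ : Γ = ∑ k ∈ Finset.Icc 1 N, (γ k)⁻¹)
    (xbar : EuclideanSpace ℝ (Fin n))
    (hxbar : xbar = Γ⁻¹ • ∑ k ∈ Finset.Icc 1 N, (γ k)⁻¹ • xh k) :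
    ∀ z ∈ X, ⟪F z, xbar - z⟫_ℝ ≤
      D ^ (p + 1) * Lp / (2 * (1 - τ ^ 2) ^ ((p - 1) / 2) * (N : ℝ) ^ ((p + 1) / 2)) := by
  intro z hz
  have hN0 : (0 : ℝ) < N := by exact_mod_cast hN
  have hτ : 0 < 1 - τ ^ 2 := by nlinarith
  have hD0 : 0 ≤ D := (norm_nonneg _).trans (hD z hz z hz)
  have hΓpos : 0 < Γ := by
    rw [hΓ]
    exact Finset.sum_pos (fun k hk => inv_pos.2 (hγpos k hk)) ⟨1, by simp [hN]⟩
  have step : ∀ w ∈ X, ∀ k ∈ Finset.Icc 1 N, (γ k)⁻¹ * ⟪F (xh k), xh k - w⟫_ℝ ≤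
      (‖x k - w‖ ^ 2 - ‖x (k + 1) - w‖ ^ 2 - (1 - τ ^ 2) * ‖xh k - x k‖ ^ 2) / 2 := by
    intro w hw k hk
    have hk' := Finset.mem_Icc.1 hk
    refine are_aux_step _ _ _ _ _ _ _ _ (hγpos k hk)
      (hstep1 k hk _ (hxX (k + 1) (Finset.mem_Icc.2 ⟨by omega, by omega⟩)))
      (hstep2 k hk w hw) ((happrox k hk (xh k)).trans (le_of_eq ?_))
    rw [hγ k]
    have : ‖xh k - x k‖ ^ p = ‖xh k - x k‖ ^ (p - 1) * ‖xh k - x k‖ := by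
      conv_lhs => rw [show p = (p - 1) + 1 by ring]
      rw [Real.rpow_add_of_nonneg (norm_nonneg _) (by linarith) zero_le_one, Real.rpow_one]
    rw [this]
    ring
  have tel : ∀ w ∈ X, ∑ k ∈ Finset.Icc 1 N, (γ k)⁻¹ * ⟪F (xh k), xh k - w⟫_ℝ ≤
      (D ^ 2 - (1 - τ ^ 2) * ∑ k ∈ Finset.Icc 1 N, ‖xh k - x k‖ ^ 2) / 2 := by
    intro w hw
    refine (Finset.sum_le_sum (step w hw)).trans ?_
    rw [← Finset.sum_div, Finset.sum_sub_distrib, ← Finset.mul_sum]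
    have ht : ∑ k ∈ Finset.Icc 1 N, (‖x k - w‖ ^ 2 - ‖x (k + 1) - w‖ ^ 2)
        = ‖x 1 - w‖ ^ 2 - ‖x (N + 1) - w‖ ^ 2 := by
      clear * -
      induction N with
      | zero => simp
      | succ m ih => rw [Finset.sum_Icc_succ_top (by omega), ih]; ring
    rw [ht]
    have h1 : ‖x 1 - w‖ ^ 2 ≤ D ^ 2 :=
      pow_le_pow_left₀ (norm_nonneg _) (hD _ (hxX 1 (by simp)) w hw) 2
    have h2 := sq_nonneg ‖x (N + 1) - w‖
    linarith
  have hsum : ∑ k ∈ Finset.Icc 1 N, ‖xh k - x k‖ ^ 2 ≤ D ^ 2 / (1 - τ ^ 2) := by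
    have h0 : 0 ≤ ∑ k ∈ Finset.Icc 1 N, (γ k)⁻¹ * ⟪F (xh k), xh k - xstar⟫_ℝ := by
      refine Finset.sum_nonneg fun k hk => mul_nonneg (inv_pos.2 (hγpos k hk)).le ?_
      have h1 := hmono _ (hxhX k hk) _ hxstarX
      have h2 := hxstar _ (hxhX k hk)
      rw [inner_sub_left] at h1
      linarith
    have h1 := tel xstar hxstarX
    rw [le_div_iff₀ hτ]
    linarith
  have hmain : Γ * ⟪F z, xbar - z⟫_ℝ ≤ D ^ 2 / 2 := by
    have e : Γ * ⟪F z, xbar - z⟫_ℝ = ∑ k ∈ Finset.Icc 1 N, (γ k)⁻¹ * ⟪F z, xh k - z⟫_ℝ := by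
      rw [hxbar, inner_sub_right, inner_smul_right, inner_sum, mul_sub, ← mul_assoc,
        mul_inv_cancel₀ hΓpos.ne', one_mul]
      simp only [inner_sub_right, inner_smul_right, mul_sub, Finset.sum_sub_distrib]
      rw [← Finset.sum_mul, ← hΓ]
    have h1 : ∑ k ∈ Finset.Icc 1 N, (γ k)⁻¹ * ⟪F z, xh k - z⟫_ℝ ≤
        ∑ k ∈ Finset.Icc 1 N, (γ k)⁻¹ * ⟪F (xh k), xh k - z⟫_ℝ := by
      refine Finset.sum_le_sum fun k hk =>
        mul_le_mul_of_nonneg_left ?_ (inv_pos.2 (hγpos k hk)).le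
      have h1 := hmono _ (hxhX k hk) _ hz
      rw [inner_sub_left] at h1
      linarith
    have h2 := tel z hz
    have h3 : 0 ≤ ∑ k ∈ Finset.Icc 1 N, ‖xh k - x k‖ ^ 2 :=
      Finset.sum_nonneg fun k _ => sq_nonneg _
    have h4 := mul_nonneg hτ.le h3
    rw [e]
    linarith
  rcases eq_or_lt_of_le hp with hp1 | hp1
  · subst hp1
    have hg : ∀ k, γ k = Lp := fun k => by rw [hγ k]; simp
    have hG : Γ = N * Lp⁻¹ := by rw [hΓ]; simp [hg]
    have e1 : ((1 : ℝ) - 1) / 2 = 0 := by norm_num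
    have e2 : ((1 : ℝ) + 1) / 2 = 1 := by norm_num
    have e3 : ((1 : ℝ) + 1) = (2 : ℕ) := by norm_num
    rw [e1, e2, Real.rpow_zero, Real.rpow_one, e3, Real.rpow_natCast, le_div_iff₀ (by positivity)]
    rw [hG] at hmain
    have := mul_le_mul_of_nonneg_right hmain (show 0 ≤ 2 * Lp by positivity)
    field_simp at this
    linarith
  · have hdpos : ∀ k ∈ Finset.Icc 1 N, 0 < ‖xh k - x k‖ := by
      intro k hk
      refine lt_of_le_of_ne (norm_nonneg _) fun h => ?_
      have := hγpos k hk
      rw [hγ k, ← h, Real.zero_rpow (by linarith)] at this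
      simp at this
    have hDpos : 0 < D := by
      have h1 : 1 ∈ Finset.Icc 1 N := by simp [hN]
      exact (hdpos 1 h1).trans_le (hD _ (hxhX 1 h1) _ (hxX 1 (by simp)))
    have hs := are_aux_sum N hN (fun k => ‖xh k - x k‖) ((p - 1) / 2) (D ^ 2 / (1 - τ ^ 2))
      (by linarith) (by positivity) hdpos hsum
    have hG : Γ = Lp⁻¹ * ∑ k ∈ Finset.Icc 1 N, (‖xh k - x k‖ ^ (2 * ((p - 1) / 2)))⁻¹ := by
      rw [hΓ, Finset.mul_sum]
      refine Finset.sum_congr rfl fun k _ => ?_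
      rw [hγ k, mul_inv, mul_div_cancel₀ _ (two_ne_zero)]
    have eA : (D ^ 2 / (1 - τ ^ 2)) ^ (-((p - 1) / 2)) =
        (1 - τ ^ 2) ^ ((p - 1) / 2) / D ^ (p - 1) := by
      rw [Real.rpow_neg (by positivity), Real.div_rpow (by positivity) hτ.le, inv_div,
        ← Real.rpow_natCast D 2, ← Real.rpow_mul hD0]
      congr 2
      push_cast
      ring
    have eN : (p - 1) / 2 + 1 = (p + 1) / 2 := by ring
    have eD : D ^ (p + 1) = D ^ (p - 1) * D ^ 2 := by
      rw [← Real.rpow_natCast D 2, ← Real.rpow_add hDpos]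
      congr 1
      push_cast
      ring
    rw [eA, eN] at hs
    have hT : 0 < (1 - τ ^ 2) ^ ((p - 1) / 2) := Real.rpow_pos_of_pos hτ _
    have hNN : 0 < (N : ℝ) ^ ((p + 1) / 2) := Real.rpow_pos_of_pos hN0 _
    have hDD : 0 < D ^ (p - 1) := Real.rpow_pos_of_pos hDpos _
    rw [eD]
    generalize (1 - τ ^ 2) ^ ((p - 1) / 2) = T at *
    generalize (N : ℝ) ^ ((p + 1) / 2) = M at *
    generalize D ^ (p - 1) = B at *
    have hlow : Lp⁻¹ * (M * (T / B)) ≤ Γ := by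
      rw [hG]
      exact mul_le_mul_of_nonneg_left hs (by positivity)
    have hlow0 : 0 < Lp⁻¹ * (M * (T / B)) := by positivity
    calc ⟪F z, xbar - z⟫_ℝ ≤ (D ^ 2 / 2) / Γ := by
          rw [le_div_iff₀ hΓpos]; linarith
      _ ≤ (D ^ 2 / 2) / (Lp⁻¹ * (M * (T / B))) :=
          div_le_div_of_nonneg_left (by positivity) hlow0 hlow
      _ = B * D ^ 2 * Lp / (2 * T * M) := by
          field_simp
end

section
/- Fix a real p ≥ 1, L_p > 0, τ ∈ (0,1], a convex set X ⊆ ℝ^n, F : ℝ^n → ℝ^n, and points x^k, x^{k+0.5}, x^{k+1} ∈ X. Set γ_k := L_p‖x^{k+0.5} − x^k‖^{p−1}. Assume (i) ⟨F̃_k(x^{k+0.5}) + γ_k(x^{k+0.5} − x^k), x − x^{k+0.5}⟩ ≥ 0 for all x ∈ X, (ii) ⟨F(x^{k+0.5}) + γ_k(x^{k+1} − x^k), x − x^{k+1}⟩ ≥ 0 for all x ∈ X, and (iii) ‖F̃_k(x) − F(x)‖ ≤ τ L_p ‖x − x^k‖^p for all x. Then for every x ∈ X, ⟨F(x^{k+0.5}),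 x^{k+0.5} − x⟩ + (γ_k/2)(1 − τ²)‖x^{k+0.5} − x^k‖² ≤ (γ_k/2)(‖x^k − x‖² − ‖x^{k+1} − x‖²). -/
open scoped InnerProductSpace

/-- Key one-iteration inequality (3.7) in the ARE analysis. -/
theorem are_one_iteration_inequality
    {n : ℕ} (X : Set (EuclideanSpace ℝ (Fin n))) (hX : Convex ℝ X)
    (F Ftil : EuclideanSpace ℝ (Fin n) → EuclideanSpace ℝ (Fin n))
    (p Lp τ : ℝ) (hp : 1 ≤ p) (hLp : 0 < Lp) (hτ0 : 0 < τ) (hτ1 : τ ≤ 1)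
    (xk xh xkp1 : EuclideanSpace ℝ (Fin n))
    (hxk : xk ∈ X) (hxh : xh ∈ X) (hxkp1 : xkp1 ∈ X)
    (γ : ℝ) (hγ : γ = Lp * ‖xh - xk‖ ^ (p - 1))
    (hstep1 : ∀ z ∈ X, 0 ≤ ⟪Ftil xh + γ • (xh - xk), z - xh⟫_ℝ)
    (hstep2 : ∀ z ∈ X, 0 ≤ ⟪F xh + γ • (xkp1 - xk), z - xkp1⟫_ℝ)
    (happrox : ∀ z, ‖Ftil z - F z‖ ≤ τ * Lp * ‖z - xk‖ ^ p) :
    ∀ z ∈ X, ⟪F xh, xh - z⟫_ℝ + γ / 2 * (1 - τ ^ 2) * ‖xh - xk‖ ^ 2 ≤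
      γ / 2 * (‖xk - z‖ ^ 2 - ‖xkp1 - z‖ ^ 2) := by
  intro z hz
  have h1 := hstep1 xkp1 hxkp1
  have h2 := hstep2 z hz
  have h3 := happrox xh
  have hγ0 : 0 ≤ γ := by rw [hγ]; positivity
  have hpow : Lp * ‖xh - xk‖ ^ p = γ * ‖xh - xk‖ := by
    rw [hγ, mul_assoc]
    congr 1
    have h := Real.rpow_add_of_nonneg (norm_nonneg (xh - xk)) (sub_nonneg.2 hp) zero_le_one
    rw [sub_add_cancel, Real.rpow_one] at h
    exact h
  rw [mul_assoc, hpow] at h3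
  have h4 := real_inner_le_norm (Ftil xh - F xh) (xkp1 - xh)
  have h5 := mul_le_mul_of_nonneg_right h3 (norm_nonneg (xkp1 - xh))
  have h6 := mul_nonneg hγ0 (sq_nonneg (τ * ‖xh - xk‖ - ‖xkp1 - xh‖))
  obtain ⟨a, ha⟩ : ∃ a, a = xh - xk := ⟨_, rfl⟩
  obtain ⟨b, hb⟩ : ∃ b, b = xkp1 - xh := ⟨_, rfl⟩
  obtain ⟨c, hc⟩ : ∃ c, c = z - xkp1 := ⟨_, rfl⟩
  have e1 : xkp1 - xk = a + b := by rw [ha, hb]; abel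
  have e2 : xh - z = -(b + c) := by rw [hb, hc]; abel
  have e3 : xk - z = -(a + b + c) := by rw [ha, hb, hc]; abel
  have e4 : xkp1 - z = -c := by rw [hc]; abel
  rw [e2, e3, e4, norm_neg, norm_neg, ← ha]
  rw [e1, ← hc] at h2
  rw [← ha, ← hb] at h1 h6 h5
  rw [← hb] at h4
  have n1 := norm_add_sq_real (a + b) c
  have n2 := norm_add_sq_real a b
  simp only [inner_add_left, inner_add_right, inner_sub_left, inner_neg_right,
    real_inner_smul_left] at *
  rw [n1, n2]
  linarith
end

section
/- Let X ⊆ ℝ^n be convex, F monotone on X, p ≥ 1 real, L_p > 0, τ ∈ (0,1), and N ≥ 1 an integer. Let x^k, x^{k+0.5}, x^{k+1} ∈ X (k = 1,…,N) be ARE iterates: with γ_k := L_p‖x^{k+0.5} − x^k‖^{p−1} > 0, (i) ⟨F̃_k(x^{k+0.5}) + γ_k(x^{k+0.5} − x^k), x − x^{k+0.5}⟩ ≥ 0 for all x ∈ X, (ii) ⟨F(x^{k+0.5}) + γ_k(x^{k+1} − x^k), x − x^{k+1}⟩ ≥ 0 for all x ∈ X, and ‖F̃_k(x) − F(x)‖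 ≤ τ L_p‖x − x^k‖^p for all x. Set Γ_N := Σ_{k=1}^N γ_k^{−1} and x̄_N := Γ_N^{−1} Σ_{k=1}^N γ_k^{−1} x^{k+0.5}. Then for every x ∈ X: ⟨F(x), x̄_N − x⟩ + ((1 − τ²)/(2Γ_N)) Σ_{k=1}^N ‖x^{k+0.5} − x^k‖² ≤ ‖x^1 − x‖²/(2Γ_N). -/
open scoped InnerProductSpace

theorem are_step_aux {E : Type*} [NormedAddCommGroup E] [InnerProductSpace ℝ E]
    (G T u v w : E) (g τ : ℝ) (hg : 0 < g)
    (h1 : 0 ≤ ⟪T + g • u, v⟫_ℝ) (h2 : 0 ≤ ⟪G + g • (u + v), w⟫_ℝ)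
    (h3 : ‖T - G‖ ≤ τ * g * ‖u‖) :
    -⟪G, v + w⟫_ℝ + g * ((1 - τ ^ 2) / 2 * ‖u‖ ^ 2) ≤
      g * ((‖u + v + w‖ ^ 2 - ‖w‖ ^ 2) / 2) := by
  have h4 : ⟪T - G, v⟫_ℝ ≤ τ * g * ‖u‖ * ‖v‖ :=
    (real_inner_le_norm _ _).trans (mul_le_mul_of_nonneg_right h3 (norm_nonneg _))
  have e1 := norm_add_sq_real (u + v) w
  have e2 := norm_add_sq_real u v
  simp only [inner_add_left, inner_add_right, inner_sub_left, real_inner_smul_left] at *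
  rw [e1, e2]
  have h5 : 0 ≤ g * (τ * ‖u‖ - ‖v‖) ^ 2 := mul_nonneg hg.le (sq_nonneg _)
  nlinarith

/-- Averaged inequality (3.9) in the ARE analysis for monotone VI. -/
theorem are_averaged_inequality_monotone
    {n : ℕ} (X : Set (EuclideanSpace ℝ (Fin n))) (hX : Convex ℝ X)
    (F : EuclideanSpace ℝ (Fin n) → EuclideanSpace ℝ (Fin n))
    (hmono : ∀ x ∈ X, ∀ y ∈ X, 0 ≤ ⟪F x - F y, x - y⟫_ℝ)
    (p Lp τ : ℝ) (hp : 1 ≤ p) (hLp : 0 < Lp) (hτ0 : 0 < τ) (hτ1 : τ < 1)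
    (N : ℕ) (hN : 1 ≤ N)
    (x xh : ℕ → EuclideanSpace ℝ (Fin n))
    (Ftil : ℕ → EuclideanSpace ℝ (Fin n) → EuclideanSpace ℝ (Fin n))
    (hxX : ∀ k ∈ Finset.Icc 1 (N + 1), x k ∈ X)
    (hxhX : ∀ k ∈ Finset.Icc 1 N, xh k ∈ X)
    (γ : ℕ → ℝ) (hγ : ∀ k, γ k = Lp * ‖xh k - x k‖ ^ (p - 1))
    (hγpos : ∀ k ∈ Finset.Icc 1 N, 0 < γ k)
    (hstep1 : ∀ k ∈ Finset.Icc 1 N, ∀ z ∈ X,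
      0 ≤ ⟪Ftil k (xh k) + γ k • (xh k - x k), z - xh k⟫_ℝ)
    (hstep2 : ∀ k ∈ Finset.Icc 1 N, ∀ z ∈ X,
      0 ≤ ⟪F (xh k) + γ k • (x (k + 1) - x k), z - x (k + 1)⟫_ℝ)
    (happrox : ∀ k ∈ Finset.Icc 1 N, ∀ z,
      ‖Ftil k z - F z‖ ≤ τ * Lp * ‖z - x k‖ ^ p)
    (Γ : ℝ) (hΓ : Γ = ∑ k ∈ Finset.Icc 1 N, (γ k)⁻¹)
    (xbar : EuclideanSpace ℝ (Fin n))
    (hxbar : xbar = Γ⁻¹ • ∑ k ∈ Finset.Icc 1 N, (γ k)⁻¹ • xh k) :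
    ∀ z ∈ X, ⟪F z, xbar - z⟫_ℝ +
        (1 - τ ^ 2) / (2 * Γ) * ∑ k ∈ Finset.Icc 1 N, ‖xh k - x k‖ ^ 2 ≤
      ‖x 1 - z‖ ^ 2 / (2 * Γ) := by
  intro z hz
  have hΓpos : 0 < Γ := by
    rw [hΓ]
    exact Finset.sum_pos (fun k hk => inv_pos.mpr (hγpos k hk)) ⟨1, by simp [hN]⟩
  have key : ∀ k ∈ Finset.Icc 1 N,
      (γ k)⁻¹ * ⟪F z, xh k - z⟫_ℝ + (1 - τ ^ 2) / 2 * ‖xh k - x k‖ ^ 2 ≤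
        (‖x k - z‖ ^ 2 - ‖x (k + 1) - z‖ ^ 2) / 2 := by
    intro k hk
    have hg := hγpos k hk
    have hk' := Finset.mem_Icc.mp hk
    have hb : x (k + 1) ∈ X := hxX _ (Finset.mem_Icc.mpr ⟨by omega, by omega⟩)
    have h1 := hstep1 k hk _ hb
    have h2 := hstep2 k hk z hz
    have h3 := happrox k hk (xh k)
    have hpow : ‖xh k - x k‖ ^ p = ‖xh k - x k‖ ^ (p - 1) * ‖xh k - x k‖ := by
      have := Real.rpow_add_one' (norm_nonneg (xh k - x k)) (y := p - 1) (by linarith)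
      rwa [sub_add_cancel] at this
    have h3' : ‖Ftil k (xh k) - F (xh k)‖ ≤ τ * γ k * ‖xh k - x k‖ := by
      rw [hγ k]
      rw [hpow] at h3
      linarith
    have e : x (k + 1) - x k = (xh k - x k) + (x (k + 1) - xh k) := by abel
    rw [e] at h2
    have h := are_step_aux _ _ _ _ _ _ _ hg h1 h2 h3'
    have e1 : x (k + 1) - xh k + (z - x (k + 1)) = -(xh k - z) := by abel
    have e2 : xh k - x k + (x (k + 1) - xh k) + (z - x (k + 1)) = z - x k := by abel
    rw [e1, e2, inner_neg_right, neg_neg, norm_sub_rev z, norm_sub_rev z] at h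
    have hm := hmono _ (hxhX k hk) z hz
    rw [inner_sub_left] at hm
    have h6 : γ k * ((γ k)⁻¹ * ⟪F z, xh k - z⟫_ℝ) = ⟪F z, xh k - z⟫_ℝ :=
      mul_inv_cancel_left₀ hg.ne' _
    refine le_of_mul_le_mul_left ?_ hg
    rw [mul_add, h6]
    linarith
  have hsum := Finset.sum_le_sum key
  have htel : ∀ M : ℕ, ∑ k ∈ Finset.Icc 1 M, (‖x k - z‖ ^ 2 - ‖x (k + 1) - z‖ ^ 2) / 2 =
      (‖x 1 - z‖ ^ 2 - ‖x (M + 1) - z‖ ^ 2) / 2 := by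
    intro M
    induction M with
    | zero => simp
    | succ m ih => rw [Finset.sum_Icc_succ_top (by omega), ih]; ring
  rw [htel, Finset.sum_add_distrib, ← Finset.mul_sum] at hsum
  have hin : ∑ k ∈ Finset.Icc 1 N, (γ k)⁻¹ * ⟪F z, xh k - z⟫_ℝ = Γ * ⟪F z, xbar - z⟫_ℝ := by
    have : Γ • (xbar - z) = ∑ k ∈ Finset.Icc 1 N, (γ k)⁻¹ • (xh k - z) := by
      simp only [smul_sub, Finset.sum_sub_distrib]
      rw [← Finset.sum_smul, ← hΓ, hxbar, smul_inv_smul₀ hΓpos.ne']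
    rw [← real_inner_smul_right, this, inner_sum]
    simp only [real_inner_smul_right]
  rw [hin] at hsum
  rw [le_div_iff₀ (by positivity)]
  have e : (⟪F z, xbar - z⟫_ℝ + (1 - τ ^ 2) / (2 * Γ) * ∑ k ∈ Finset.Icc 1 N, ‖xh k - x k‖ ^ 2)
      * (2 * Γ) = 2 * (Γ * ⟪F z, xbar - z⟫_ℝ +
        (1 - τ ^ 2) / 2 * ∑ k ∈ Finset.Icc 1 N, ‖xh k - x k‖ ^ 2) := by
    field_simp
  rw [e]
  nlinarith [sq_nonneg ‖x (N + 1) - z‖]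
end

section
/- Let X ⊆ ℝ^n be convex and F μ-strongly monotone on X with μ > 0. Fix p ≥ 1 real, L_p > 0, τ ∈ (0,1], and points x^k, x^{k+0.5}, x^{k+1} ∈ X with γ_k := L_p‖x^{k+0.5} − x^k‖^{p−1}. Assume (i) ⟨F̃_k(x^{k+0.5}) + γ_k(x^{k+0.5} − x^k), x − x^{k+0.5}⟩ ≥ 0 for all x ∈ X, (ii) ⟨F(x^{k+0.5}) + γ_k(x^{k+1} − x^k), x − x^{k+1}⟩ ≥ 0 for all x ∈ X, and ‖F̃_k(x) − F(x)‖ ≤ τ L_p‖x − x^k‖^p for all x. Then for every x ∈ X: μ‖x^{k+0.5} − x‖² + ⟨F(x), x^{k+0.5} − x⟩ + (γ_k/2)(1 − τ²)‖x^{k+0.5} − x^k‖² ≤ (γ_k/2)(‖x^k − x‖² − ‖x^{k+1} − x‖²). -/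
open scoped InnerProductSpace

/-- One-iteration inequality (3.11) in the strongly monotone ARE analysis. -/
theorem are_one_iteration_inequality_strongly_monotone
    {n : ℕ} (X : Set (EuclideanSpace ℝ (Fin n))) (hX : Convex ℝ X)
    (F : EuclideanSpace ℝ (Fin n) → EuclideanSpace ℝ (Fin n))
    (μ : ℝ) (hμ : 0 < μ)
    (hsmono : ∀ x ∈ X, ∀ y ∈ X, μ * ‖x - y‖ ^ 2 ≤ ⟪F x - F y, x - y⟫_ℝ)
    (Ftil : EuclideanSpace ℝ (Fin n) → EuclideanSpace ℝ (Fin n))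
    (p Lp τ : ℝ) (hp : 1 ≤ p) (hLp : 0 < Lp) (hτ0 : 0 < τ) (hτ1 : τ ≤ 1)
    (xk xh xkp1 : EuclideanSpace ℝ (Fin n))
    (hxk : xk ∈ X) (hxh : xh ∈ X) (hxkp1 : xkp1 ∈ X)
    (γ : ℝ) (hγ : γ = Lp * ‖xh - xk‖ ^ (p - 1))
    (hstep1 : ∀ z ∈ X, 0 ≤ ⟪Ftil xh + γ • (xh - xk), z - xh⟫_ℝ)
    (hstep2 : ∀ z ∈ X, 0 ≤ ⟪F xh + γ • (xkp1 - xk), z - xkp1⟫_ℝ)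
    (happrox : ∀ z, ‖Ftil z - F z‖ ≤ τ * Lp * ‖z - xk‖ ^ p) :
    ∀ z ∈ X, μ * ‖xh - z‖ ^ 2 + ⟪F z, xh - z⟫_ℝ + γ / 2 * (1 - τ ^ 2) * ‖xh - xk‖ ^ 2 ≤
      γ / 2 * (‖xk - z‖ ^ 2 - ‖xkp1 - z‖ ^ 2) := by
  intro z hz
  have hγ0 : 0 ≤ γ := by rw [hγ]; positivity
  have hpow : Lp * ‖xh - xk‖ ^ p = γ * ‖xh - xk‖ := by
    rw [hγ]
    rcases eq_or_lt_of_le (norm_nonneg (xh - xk)) with h | h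
    · rw [← h, Real.zero_rpow (by linarith)]; ring
    · rw [Real.rpow_sub_one h.ne']; field_simp
  have h0 := hsmono xh hxh z hz
  have h1 := hstep1 xkp1 hxkp1
  have h2 := hstep2 z hz
  have h3 := happrox xh
  rw [mul_assoc, hpow] at h3
  have h4 : ⟪F xh - Ftil xh, xh - xkp1⟫_ℝ ≤ τ * (γ * ‖xh - xk‖) * ‖xkp1 - xh‖ := by
    refine (real_inner_le_norm _ _).trans ?_
    rw [norm_sub_rev (F xh), norm_sub_rev xh xkp1]
    gcongr
  have h5 : τ * (γ * ‖xh - xk‖) * ‖xkp1 - xh‖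
      ≤ γ / 2 * (τ ^ 2 * ‖xh - xk‖ ^ 2 + ‖xkp1 - xh‖ ^ 2) := by
    nlinarith [mul_nonneg hγ0 (sq_nonneg (τ * ‖xh - xk‖ - ‖xkp1 - xh‖))]
  have h6 := h4.trans h5
  clear h3 h4 h5 hpow
  simp only [← real_inner_self_eq_norm_sq, inner_sub_left, inner_sub_right, inner_add_left,
    real_inner_smul_left] at *
  simp only [real_inner_comm xk xh, real_inner_comm xk xkp1, real_inner_comm xk z,
    real_inner_comm xh xkp1, real_inner_comm xh z, real_inner_comm xkp1 z] at h0 h1 h2 h6 ⊢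
  linarith
end

section
/- Let X ⊆ ℝ^n be convex, F μ-strongly monotone on X with μ > 0, and x* ∈ X a solution of VI_X(F). Fix p ≥ 1 real, L_p > 0, τ ∈ (0,1), N ≥ 1, and ARE iterates x^k, x^{k+0.5}, x^{k+1} ∈ X (k = 1,…,N) with γ_k := L_p‖x^{k+0.5} − x^k‖^{p−1} > 0 for all k, satisfying the two ARE optimality conditions and the approximation bound. Set Γ_N := Σ_{k=1}^N γ_k^{−1} and x̄_N := Γ_N^{−1} Σ_{k=1}^N γ_k^{−1} x^{k+0.5}. Then μ Γ_N ‖x̄_N − x*‖² ≤ (1/2)‖x^1 − x*‖² − (1/2)‖x^{N+1} − x*‖² − ((1 − τ²)/2) Σ_{k=1}^N ‖x^{k+0.5} − x^k‖². -/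
open scoped InnerProductSpace

lemma are_step {E : Type*} [NormedAddCommGroup E] [InnerProductSpace ℝ E]
    (a b c s f t : E) (g m τ : ℝ) (hg : 0 < g)
    (h1 : 0 ≤ ⟪t + g • (b - a), c - b⟫_ℝ)
    (h2 : 0 ≤ ⟪f + g • (c - a), s - c⟫_ℝ)
    (h3 : m ≤ ⟪f, b - s⟫_ℝ)
    (h4 : ‖t - f‖ ≤ τ * g * ‖b - a‖) :
    g⁻¹ * m ≤ 1 / 2 * ‖a - s‖ ^ 2 - 1 / 2 * ‖c - s‖ ^ 2
      - (1 - τ ^ 2) / 2 * ‖b - a‖ ^ 2 := by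
  have h5 : ⟪t - f, c - b⟫_ℝ ≤ τ * g * ‖b - a‖ * ‖c - b‖ :=
    (real_inner_le_norm _ _).trans (mul_le_mul_of_nonneg_right h4 (norm_nonneg _))
  have h6 : τ * g * ‖b - a‖ * ‖c - b‖ ≤ g * (τ ^ 2 / 2 * ‖b - a‖ ^ 2 + 1 / 2 * ‖c - b‖ ^ 2) := by
    nlinarith [mul_nonneg hg.le (sq_nonneg (τ * ‖b - a‖ - ‖c - b‖))]
  have e1 : ‖c - a‖ ^ 2 = ‖b - a‖ ^ 2 + 2 * ⟪b - a, c - b⟫_ℝ + ‖c - b‖ ^ 2 := by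
    rw [← norm_add_sq_real]; congr 2; abel
  have e2 : ‖a - s‖ ^ 2 = ‖c - a‖ ^ 2 + 2 * ⟪c - a, s - c⟫_ℝ + ‖c - s‖ ^ 2 := by
    rw [norm_sub_rev a s, norm_sub_rev c s, ← norm_add_sq_real]; congr 2; abel
  have e3 : ⟪f, b - s⟫_ℝ = ⟪t - f, c - b⟫_ℝ - ⟪t, c - b⟫_ℝ - ⟪f, s - c⟫_ℝ := by
    simp only [inner_sub_left, inner_sub_right]; ring
  rw [inner_add_left, real_inner_smul_left] at h1 h2
  rw [inv_mul_le_iff₀ hg]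
  have e4 : 1 / 2 * ‖a - s‖ ^ 2 - 1 / 2 * ‖c - s‖ ^ 2 - (1 - τ ^ 2) / 2 * ‖b - a‖ ^ 2
      = (τ ^ 2 / 2 * ‖b - a‖ ^ 2 + 1 / 2 * ‖c - b‖ ^ 2) + ⟪b - a, c - b⟫_ℝ
        + ⟪c - a, s - c⟫_ℝ := by
    rw [e2, e1]; ring
  rw [e4]
  linarith

/-- Summed inequality (3.12) in the strongly monotone ARE analysis. -/
theorem are_summed_inequality_strongly_monotone
    {n : ℕ} (X : Set (EuclideanSpace ℝ (Fin n))) (hX : Convex ℝ X)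
    (F : EuclideanSpace ℝ (Fin n) → EuclideanSpace ℝ (Fin n))
    (μ : ℝ) (hμ : 0 < μ)
    (hsmono : ∀ x ∈ X, ∀ y ∈ X, μ * ‖x - y‖ ^ 2 ≤ ⟪F x - F y, x - y⟫_ℝ)
    (xstar : EuclideanSpace ℝ (Fin n)) (hxstarX : xstar ∈ X)
    (hxstar : ∀ x ∈ X, 0 ≤ ⟪F xstar, x - xstar⟫_ℝ)
    (p Lp τ : ℝ) (hp : 1 ≤ p) (hLp : 0 < Lp) (hτ0 : 0 < τ) (hτ1 : τ < 1)
    (N : ℕ) (hN : 1 ≤ N)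
    (x xh : ℕ → EuclideanSpace ℝ (Fin n))
    (Ftil : ℕ → EuclideanSpace ℝ (Fin n) → EuclideanSpace ℝ (Fin n))
    (hxX : ∀ k ∈ Finset.Icc 1 (N + 1), x k ∈ X)
    (hxhX : ∀ k ∈ Finset.Icc 1 N, xh k ∈ X)
    (γ : ℕ → ℝ) (hγ : ∀ k, γ k = Lp * ‖xh k - x k‖ ^ (p - 1))
    (hγpos : ∀ k ∈ Finset.Icc 1 N, 0 < γ k)
    (hstep1 : ∀ k ∈ Finset.Icc 1 N, ∀ z ∈ X,
      0 ≤ ⟪Ftil k (xh k) + γ k • (xh k - x k), z - xh k⟫_ℝ)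
    (hstep2 : ∀ k ∈ Finset.Icc 1 N, ∀ z ∈ X,
      0 ≤ ⟪F (xh k) + γ k • (x (k + 1) - x k), z - x (k + 1)⟫_ℝ)
    (happrox : ∀ k ∈ Finset.Icc 1 N, ∀ z,
      ‖Ftil k z - F z‖ ≤ τ * Lp * ‖z - x k‖ ^ p)
    (Γ : ℝ) (hΓ : Γ = ∑ k ∈ Finset.Icc 1 N, (γ k)⁻¹)
    (xbar : EuclideanSpace ℝ (Fin n))
    (hxbar : xbar = Γ⁻¹ • ∑ k ∈ Finset.Icc 1 N, (γ k)⁻¹ • xh k) :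
    μ * Γ * ‖xbar - xstar‖ ^ 2 ≤
      1 / 2 * ‖x 1 - xstar‖ ^ 2 - 1 / 2 * ‖x (N + 1) - xstar‖ ^ 2 -
        (1 - τ ^ 2) / 2 * ∑ k ∈ Finset.Icc 1 N, ‖xh k - x k‖ ^ 2 := by
  have hstep : ∀ k ∈ Finset.Icc 1 N, (γ k)⁻¹ * (μ * ‖xh k - xstar‖ ^ 2) ≤
      (1 / 2 * ‖x k - xstar‖ ^ 2 - 1 / 2 * ‖x (k + 1) - xstar‖ ^ 2)
        - (1 - τ ^ 2) / 2 * ‖xh k - x k‖ ^ 2 := by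
    intro k hk
    have hk' := Finset.mem_Icc.mp hk
    refine are_step _ _ _ _ (F (xh k)) (Ftil k (xh k)) _ _ _ (hγpos k hk)
      (hstep1 k hk _ (hxX _ (Finset.mem_Icc.mpr ⟨by omega, by omega⟩)))
      (hstep2 k hk _ hxstarX) ?_ ?_
    · have h1 := hsmono _ (hxhX k hk) _ hxstarX
      have h2 := hxstar _ (hxhX k hk)
      rw [inner_sub_left] at h1
      linarith
    · refine (happrox k hk _).trans (le_of_eq ?_)
      have : ‖xh k - x k‖ ^ p = ‖xh k - x k‖ ^ (p - 1) * ‖xh k - x k‖ := by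
        conv_lhs => rw [show p = (p - 1) + 1 by ring]
        rw [Real.rpow_add_of_nonneg (norm_nonneg _) (by linarith) zero_le_one, Real.rpow_one]
      rw [hγ, this]; ring
  have hsum := Finset.sum_le_sum hstep
  have htel : ∀ M : ℕ, ∑ k ∈ Finset.Icc 1 M,
      (1 / 2 * ‖x k - xstar‖ ^ 2 - 1 / 2 * ‖x (k + 1) - xstar‖ ^ 2) =
      1 / 2 * ‖x 1 - xstar‖ ^ 2 - 1 / 2 * ‖x (M + 1) - xstar‖ ^ 2 := by
    intro M
    induction M with
    | zero => simp
    | succ M ih => rw [Finset.sum_Icc_succ_top (by omega), ih]; ring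
  rw [Finset.sum_sub_distrib, htel, ← Finset.mul_sum] at hsum
  refine le_trans ?_ hsum
  have hΓpos : 0 < Γ := by
    rw [hΓ]
    exact Finset.sum_pos (fun k hk => inv_pos.mpr (hγpos k hk))
      ⟨1, Finset.mem_Icc.mpr ⟨le_rfl, hN⟩⟩
  have hS : ∑ k ∈ Finset.Icc 1 N, (γ k)⁻¹ • (xh k - xstar) = Γ • (xbar - xstar) := by
    simp only [smul_sub, Finset.sum_sub_distrib]
    rw [← Finset.sum_smul, ← hΓ, hxbar, smul_inv_smul₀ hΓpos.ne']
  have hJ : ∑ k ∈ Finset.Icc 1 N, (μ * (2 * ⟪(γ k)⁻¹ • (xh k - xstar), xbar - xstar⟫_ℝ)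
      - (γ k)⁻¹ * (μ * ‖xbar - xstar‖ ^ 2)) ≤
      ∑ k ∈ Finset.Icc 1 N, (γ k)⁻¹ * (μ * ‖xh k - xstar‖ ^ 2) := by
    refine Finset.sum_le_sum fun k hk => ?_
    have h0 := norm_sub_sq_real (xh k - xstar) (xbar - xstar)
    have h1 := mul_nonneg (mul_nonneg (inv_pos.mpr (hγpos k hk)).le hμ.le)
      (sq_nonneg ‖xh k - xstar - (xbar - xstar)‖)
    rw [h0] at h1
    rw [real_inner_smul_left]
    linarith
  refine le_trans (le_of_eq ?_) hJ
  rw [Finset.sum_sub_distrib, ← Finset.mul_sum, ← Finset.mul_sum, ← sum_inner, hS,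
    ← Finset.sum_mul, ← hΓ, real_inner_smul_left, real_inner_self_eq_norm_sq]
  ring
end

section
/- (One-epoch bound for ARE-restart.) Let X ⊆ ℝ^n be convex, F μ-strongly monotone on X with μ > 0, and x* ∈ X a solution of VI_X(F) with x^1 ≠ x*. Fix p ≥ 1 real, L_p > 0, τ ∈ (0,1), N ≥ 1, and ARE iterates x^k, x^{k+0.5}, x^{k+1} ∈ X (k = 1,…,N) with γ_k := L_p‖x^{k+0.5} − x^k‖^{p−1} > 0 for all k, satisfying the two ARE optimality conditions and the approximation bound. Set Γ_N := Σ_{k=1}^N γ_k^{−1} and x̄_N := Γ_N^{−1} Σ_{k=1}^N γ_k^{−1} x^{k+0.5}. Then ‖x̄_N − x*‖² ≤ (L_p/(2μ)) · ‖x^1 − x*‖^{p+1} / ((1 − τ²)^{(p−1)/2} N^{(p+1)/2}). -/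
open scoped InnerProductSpace

lemma aux_step {E : Type*} [NormedAddCommGroup E] [InnerProductSpace ℝ E]
    (a h b s Fh Th : E) (g τ I : ℝ) (hg : 0 < g)
    (h1 : 0 ≤ ⟪Th + g • (h - a), b - h⟫_ℝ)
    (h2 : 0 ≤ ⟪Fh + g • (b - a), s - b⟫_ℝ)
    (h3 : ‖Th - Fh‖ ≤ τ * g * ‖h - a‖)
    (h4 : I ≤ ⟪Fh, h - s⟫_ℝ) :
    g⁻¹ * I + (1 - τ ^ 2) / 2 * ‖h - a‖ ^ 2 ≤ ‖a - s‖ ^ 2 / 2 - ‖b - s‖ ^ 2 / 2 := by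
  have e1 : ⟪Th - Fh, b - h⟫_ℝ ≤ τ * g * ‖h - a‖ * ‖b - h‖ :=
    (real_inner_le_norm _ _).trans (mul_le_mul_of_nonneg_right h3 (norm_nonneg _))
  have e2 : τ * g * ‖h - a‖ * ‖b - h‖ ≤ g * ((τ ^ 2 * ‖h - a‖ ^ 2 + ‖b - h‖ ^ 2) / 2) := by
    have : 0 ≤ g * (τ * ‖h - a‖ - ‖b - h‖) ^ 2 := by positivity
    nlinarith
  have k1 : ⟪h - a, b - h⟫_ℝ = (‖b - a‖ ^ 2 - ‖h - a‖ ^ 2 - ‖b - h‖ ^ 2) / 2 := by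
    have : b - a = (h - a) + (b - h) := by abel
    rw [this, norm_add_sq_real]; ring
  have k2 : ⟪b - a, s - b⟫_ℝ = (‖a - s‖ ^ 2 - ‖b - a‖ ^ 2 - ‖b - s‖ ^ 2) / 2 := by
    have : a - s = -((b - a) + (s - b)) := by abel
    rw [this, norm_neg, norm_add_sq_real, norm_sub_rev s b]; ring
  have k3 : ⟪Fh, h - s⟫_ℝ = -⟪Fh, s - b⟫_ℝ - ⟪Fh, b - h⟫_ℝ := by
    simp only [inner_sub_right]; ring
  rw [inner_add_left, real_inner_smul_left, k1] at h1
  rw [inner_add_left, real_inner_smul_left, k2] at h2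
  rw [inner_sub_left] at e1
  have key : I ≤ g * (‖a - s‖ ^ 2 / 2 - ‖b - s‖ ^ 2 / 2 - (1 - τ ^ 2) / 2 * ‖h - a‖ ^ 2) := by
    nlinarith
  have := mul_le_mul_of_nonneg_left key (inv_pos.2 hg).le
  rw [inv_mul_cancel_left₀ hg.ne'] at this
  linarith

lemma aux_tele (f d : ℕ → ℝ) (M : ℕ) (h : ∀ k ∈ Finset.Icc 1 M, f k ≤ d k - d (k + 1)) :
    ∑ k ∈ Finset.Icc 1 M, f k ≤ d 1 - d (M + 1) := by
  induction M with
  | zero => simp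
  | succ M ih =>
    rw [Finset.sum_Icc_succ_top (by omega)]
    have h1 := ih (fun k hk => h k (by simp only [Finset.mem_Icc] at hk ⊢; omega))
    have h2 := h (M + 1) (by simp)
    linarith

lemma aux_jensen {E : Type*} [NormedAddCommGroup E] [InnerProductSpace ℝ E]
    (S : Finset ℕ) (w : ℕ → ℝ) (v : ℕ → E) (s xb : E) (hw : ∀ k ∈ S, 0 < w k)
    (hS : 0 < ∑ k ∈ S, w k) (hx : xb = (∑ k ∈ S, w k)⁻¹ • ∑ k ∈ S, w k • v k) :
    (∑ k ∈ S, w k) * ‖xb - s‖ ^ 2 ≤ ∑ k ∈ S, w k * ‖v k - s‖ ^ 2 := by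
  have hV : ∑ k ∈ S, w k • (v k - s) = (∑ k ∈ S, w k) • (xb - s) := by
    rw [hx, smul_sub, smul_inv_smul₀ hS.ne', Finset.sum_smul, ← Finset.sum_sub_distrib]
    simp only [smul_sub]
  have h1 : ∑ k ∈ S, w k * ⟪v k - s, xb - s⟫_ℝ = (∑ k ∈ S, w k) * ‖xb - s‖ ^ 2 := by
    have := congrArg (fun z => ⟪z, xb - s⟫_ℝ) hV
    simpa only [sum_inner, real_inner_smul_left, real_inner_self_eq_norm_sq] using this
  have h2 : ∑ k ∈ S, (2 * (w k * ⟪v k - s, xb - s⟫_ℝ) - w k * ‖xb - s‖ ^ 2)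
      ≤ ∑ k ∈ S, w k * ‖v k - s‖ ^ 2 := by
    apply Finset.sum_le_sum
    intro k hk
    have := norm_sub_sq_real (v k - s) (xb - s)
    have h3 : 0 ≤ w k * ‖(v k - s) - (xb - s)‖ ^ 2 := mul_nonneg (hw k hk).le (by positivity)
    rw [this] at h3
    linarith
  rw [Finset.sum_sub_distrib, ← Finset.mul_sum, h1, ← Finset.sum_mul] at h2
  linarith

lemma aux_bern (u m q : ℝ) (hm : 0 < m) (hq : 0 ≤ q) (hu : 0 < u ∨ q = 0) :
    (m ^ q)⁻¹ * (1 - q * (u / m - 1)) ≤ (u ^ q)⁻¹ := by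
  rcases hu with hu | hu
  · have ht : 0 < u / m := by positivity
    have h1 : 1 - q * (u / m - 1) ≤ ((u / m) ^ q)⁻¹ := by
      rw [← Real.rpow_neg ht.le, Real.rpow_def_of_pos ht]
      have := Real.add_one_le_exp (Real.log (u / m) * -q)
      have := mul_le_mul_of_nonneg_left (Real.log_le_sub_one_of_pos ht) hq
      linarith
    have hmq : 0 < m ^ q := Real.rpow_pos_of_pos hm q
    calc _ ≤ (m ^ q)⁻¹ * ((u / m) ^ q)⁻¹ := mul_le_mul_of_nonneg_left h1 (by positivity)
      _ = _ := by
        rw [← mul_inv, ← Real.mul_rpow hm.le ht.le, mul_div_cancel₀ _ hm.ne']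
  · subst hu; simp

/-- One-epoch bound for ARE-restart in the strongly monotone case. -/
theorem are_restart_one_epoch_bound
    {n : ℕ} (X : Set (EuclideanSpace ℝ (Fin n))) (hX : Convex ℝ X)
    (F : EuclideanSpace ℝ (Fin n) → EuclideanSpace ℝ (Fin n))
    (μ : ℝ) (hμ : 0 < μ)
    (hsmono : ∀ x ∈ X, ∀ y ∈ X, μ * ‖x - y‖ ^ 2 ≤ ⟪F x - F y, x - y⟫_ℝ)
    (xstar : EuclideanSpace ℝ (Fin n)) (hxstarX : xstar ∈ X)
    (hxstar : ∀ x ∈ X, 0 ≤ ⟪F xstar, x - xstar⟫_ℝ)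
    (p Lp τ : ℝ) (hp : 1 ≤ p) (hLp : 0 < Lp) (hτ0 : 0 < τ) (hτ1 : τ < 1)
    (N : ℕ) (hN : 1 ≤ N)
    (x xh : ℕ → EuclideanSpace ℝ (Fin n))
    (Ftil : ℕ → EuclideanSpace ℝ (Fin n) → EuclideanSpace ℝ (Fin n))
    (hxX : ∀ k ∈ Finset.Icc 1 (N + 1), x k ∈ X)
    (hxhX : ∀ k ∈ Finset.Icc 1 N, xh k ∈ X)
    (hx1 : x 1 ≠ xstar)
    (γ : ℕ → ℝ) (hγ : ∀ k, γ k = Lp * ‖xh k - x k‖ ^ (p - 1))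
    (hγpos : ∀ k ∈ Finset.Icc 1 N, 0 < γ k)
    (hstep1 : ∀ k ∈ Finset.Icc 1 N, ∀ z ∈ X,
      0 ≤ ⟪Ftil k (xh k) + γ k • (xh k - x k), z - xh k⟫_ℝ)
    (hstep2 : ∀ k ∈ Finset.Icc 1 N, ∀ z ∈ X,
      0 ≤ ⟪F (xh k) + γ k • (x (k + 1) - x k), z - x (k + 1)⟫_ℝ)
    (happrox : ∀ k ∈ Finset.Icc 1 N, ∀ z,
      ‖Ftil k z - F z‖ ≤ τ * Lp * ‖z - x k‖ ^ p)
    (Γ : ℝ) (hΓ : Γ = ∑ k ∈ Finset.Icc 1 N, (γ k)⁻¹)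
    (xbar : EuclideanSpace ℝ (Fin n))
    (hxbar : xbar = Γ⁻¹ • ∑ k ∈ Finset.Icc 1 N, (γ k)⁻¹ • xh k) :
    ‖xbar - xstar‖ ^ 2 ≤
      Lp / (2 * μ) * ‖x 1 - xstar‖ ^ (p + 1) /
        ((1 - τ ^ 2) ^ ((p - 1) / 2) * (N : ℝ) ^ ((p + 1) / 2)) := by
  have hI : ∀ k ∈ Finset.Icc 1 N, 0 < (γ k)⁻¹ := fun k hk => inv_pos.2 (hγpos k hk)
  have hΓpos : 0 < Γ := by
    rw [hΓ]; exact Finset.sum_pos hI ⟨1, by simp [hN]⟩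
  have hD : 0 < ‖x 1 - xstar‖ := norm_pos_iff.2 (sub_ne_zero.2 hx1)
  have hc : 0 < 1 - τ ^ 2 := by nlinarith
  have hNpos : (0 : ℝ) < N := by exact_mod_cast hN
  set D := ‖x 1 - xstar‖ with hDdef
  have hsum := aux_tele
    (fun k => (γ k)⁻¹ * (μ * ‖xh k - xstar‖ ^ 2) + (1 - τ ^ 2) / 2 * ‖xh k - x k‖ ^ 2)
    (fun k => ‖x k - xstar‖ ^ 2 / 2) N (by
      intro k hk
      have hk1 : k + 1 ∈ Finset.Icc 1 (N + 1) := by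
        simp only [Finset.mem_Icc] at hk ⊢; omega
      refine aux_step _ _ _ _ (F (xh k)) (Ftil k (xh k)) _ _ _ (hγpos k hk)
        (hstep1 k hk _ (hxX _ hk1)) (hstep2 k hk _ hxstarX) ?_ ?_
      · refine (happrox k hk _).trans (le_of_eq ?_)
        have : ‖xh k - x k‖ ^ p = ‖xh k - x k‖ ^ (p - 1) * ‖xh k - x k‖ := by
          rcases (norm_nonneg (xh k - x k)).eq_or_lt with h0 | h0
          · rw [← h0, Real.zero_rpow (by linarith), mul_zero]
          · rw [← Real.rpow_add_one h0.ne', sub_add_cancel]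
        rw [hγ, this]; ring
      · have h1 := hsmono _ (hxhX k hk) _ hxstarX
        have h2 := hxstar _ (hxhX k hk)
        rw [inner_sub_left] at h1
        linarith)
  simp only [Finset.sum_add_distrib, ← Finset.mul_sum] at hsum
  have hlast : 0 ≤ ‖x (N + 1) - xstar‖ ^ 2 / 2 := by positivity
  have hsplit : ∑ k ∈ Finset.Icc 1 N, (γ k)⁻¹ * (μ * ‖xh k - xstar‖ ^ 2)
      = μ * ∑ k ∈ Finset.Icc 1 N, (γ k)⁻¹ * ‖xh k - xstar‖ ^ 2 := by
    rw [Finset.mul_sum]; exact Finset.sum_congr rfl fun k _ => by ring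
  rw [hsplit] at hsum
  have hA : 0 ≤ ∑ k ∈ Finset.Icc 1 N, (γ k)⁻¹ * ‖xh k - xstar‖ ^ 2 :=
    Finset.sum_nonneg fun k hk => mul_nonneg (hI k hk).le (by positivity)
  have hB : 0 ≤ ∑ k ∈ Finset.Icc 1 N, ‖xh k - x k‖ ^ 2 :=
    Finset.sum_nonneg fun k hk => by positivity
  have hμA := mul_nonneg hμ.le hA
  have hcB := mul_nonneg hc.le hB
  have hJ := aux_jensen (Finset.Icc 1 N) (fun k => (γ k)⁻¹) xh xstar xbar hI
    (by rw [← hΓ]; exact hΓpos) (by rw [← hΓ]; exact hxbar)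
  rw [← hΓ] at hJ
  have hJ2 : μ * (Γ * ‖xbar - xstar‖ ^ 2) ≤ D ^ 2 / 2 := by
    have := mul_le_mul_of_nonneg_left hJ hμ.le
    linarith
  -- lower bound on Γ
  set q := (p - 1) / 2 with hq
  have hq0 : 0 ≤ q := by rw [hq]; linarith
  set m := D ^ 2 / ((1 - τ ^ 2) * N) with hm
  have hmpos : 0 < m := by positivity
  have hmq : 0 < m ^ q := Real.rpow_pos_of_pos hmpos q
  have hsq : ∀ r : ℝ, 0 ≤ r → (r ^ 2) ^ q = r ^ (p - 1) := by
    intro r hr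
    rw [← Real.rpow_natCast, ← Real.rpow_mul hr, hq]
    congr 1; push_cast; ring
  have hBm : (∑ k ∈ Finset.Icc 1 N, ‖xh k - x k‖ ^ 2) / m ≤ N := by
    rw [div_le_iff₀ hmpos, hm]
    have : (N : ℝ) * (D ^ 2 / ((1 - τ ^ 2) * N)) = D ^ 2 / (1 - τ ^ 2) := by
      field_simp
    rw [this, le_div_iff₀ hc]
    linarith
  have hΓlow : Lp⁻¹ * ((m ^ q)⁻¹ * N) ≤ Γ := by
    have h1 : ∑ k ∈ Finset.Icc 1 N,
        Lp⁻¹ * ((m ^ q)⁻¹ * (1 - q * (‖xh k - x k‖ ^ 2 / m - 1))) ≤ Γ := by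
      rw [hΓ]
      apply Finset.sum_le_sum
      intro k hk
      rw [hγ k, mul_inv, ← hsq _ (norm_nonneg _)]
      refine mul_le_mul_of_nonneg_left (aux_bern _ _ _ hmpos hq0 ?_) (by positivity)
      rcases (norm_nonneg (xh k - x k)).eq_or_lt with h0 | h0
      · right
        by_contra hne
        have h5 := hγpos k hk
        rw [hγ k, ← h0, Real.zero_rpow (fun h => hne (by rw [hq, h]; simp))] at h5
        simp at h5
      · left; positivity
    refine le_trans ?_ h1
    rw [← Finset.mul_sum, ← Finset.mul_sum, Finset.sum_sub_distrib, ← Finset.mul_sum,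
      Finset.sum_sub_distrib, ← Finset.sum_div]
    simp only [Finset.sum_const, Nat.card_Icc, add_tsub_cancel_right, nsmul_eq_mul, mul_one]
    refine mul_le_mul_of_nonneg_left (mul_le_mul_of_nonneg_left ?_ (by positivity)) (by positivity)
    nlinarith
  have hfin : μ * ((Lp⁻¹ * ((m ^ q)⁻¹ * N)) * ‖xbar - xstar‖ ^ 2) ≤ D ^ 2 / 2 :=
    le_trans (by gcongr) hJ2
  have hmexp : m ^ q = D ^ (p - 1) / ((1 - τ ^ 2) ^ q * (N : ℝ) ^ q) := by
    rw [hm, Real.div_rpow (by positivity) (by positivity), Real.mul_rpow hc.le hNpos.le,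
      hsq _ hD.le]
  have hNe : (N : ℝ) ^ ((p + 1) / 2) = (N : ℝ) ^ q * N := by
    rw [← Real.rpow_add_one hNpos.ne', hq]; congr 1; ring
  have hDe : D ^ (p + 1) = D ^ (p - 1) * D ^ 2 := by
    rw [← Real.rpow_natCast D 2, ← Real.rpow_add hD]; congr 1; push_cast; ring
  have e1 : 0 < (1 - τ ^ 2) ^ q := Real.rpow_pos_of_pos hc q
  have e2 : 0 < (N : ℝ) ^ q := Real.rpow_pos_of_pos hNpos q
  have hR : Lp / (2 * μ) * D ^ (p + 1) / ((1 - τ ^ 2) ^ q * (N : ℝ) ^ ((p + 1) / 2))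
      = (D ^ 2 / 2) / (μ * (Lp⁻¹ * ((m ^ q)⁻¹ * N))) := by
    have e3 : 0 < D ^ (p - 1) := Real.rpow_pos_of_pos hD _
    rw [hNe, hDe, hmexp]
    generalize (1 - τ ^ 2) ^ q = c at *
    generalize (N : ℝ) ^ q = M at *
    generalize D ^ (p - 1) = G at *
    field_simp
  rw [hR, le_div_iff₀ (by positivity)]
  linarith
end

section
/- Let X ⊆ ℝ^n be convex, F μ-strongly monotone on X with μ > 0, and x* ∈ X a solution of VI_X(F). Fix p ≥ 1 real, L_p > 0, τ ∈ (0,1], and points x^k, x^{k+0.5} ∈ X with γ_k := L_p‖x^{k+0.5} − x^k‖^{p−1}. Assume ⟨F̃_k(x^{k+0.5}) + γ_k(x^{k+0.5} − x^k), x − x^{k+0.5}⟩ ≥ 0 for all x ∈ X, and ‖F̃_k(x) − F(x)‖ ≤ τ L_p‖x − x^k‖^p for all x. Then ‖x^{k+0.5} − x*‖ ≤ ((1 + τ) L_p / μ) · ‖x^{k+0.5} − x^k‖^p. -/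
open scoped InnerProductSpace

/-- Bound (4.3): the regularized step is `p`-th order close to the solution. -/
theorem are_regularized_step_bound
    {n : ℕ} (X : Set (EuclideanSpace ℝ (Fin n))) (hX : Convex ℝ X)
    (F : EuclideanSpace ℝ (Fin n) → EuclideanSpace ℝ (Fin n))
    (μ : ℝ) (hμ : 0 < μ)
    (hsmono : ∀ x ∈ X, ∀ y ∈ X, μ * ‖x - y‖ ^ 2 ≤ ⟪F x - F y, x - y⟫_ℝ)
    (xstar : EuclideanSpace ℝ (Fin n)) (hxstarX : xstar ∈ X)
    (hxstar : ∀ x ∈ X, 0 ≤ ⟪F xstar, x - xstar⟫_ℝ)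
    (Ftil : EuclideanSpace ℝ (Fin n) → EuclideanSpace ℝ (Fin n))
    (p Lp τ : ℝ) (hp : 1 ≤ p) (hLp : 0 < Lp) (hτ0 : 0 < τ) (hτ1 : τ ≤ 1)
    (xk xh : EuclideanSpace ℝ (Fin n)) (hxk : xk ∈ X) (hxh : xh ∈ X)
    (γ : ℝ) (hγ : γ = Lp * ‖xh - xk‖ ^ (p - 1))
    (hstep1 : ∀ z ∈ X, 0 ≤ ⟪Ftil xh + γ • (xh - xk), z - xh⟫_ℝ)
    (happrox : ∀ z, ‖Ftil z - F z‖ ≤ τ * Lp * ‖z - xk‖ ^ p) :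
    ‖xh - xstar‖ ≤ (1 + τ) * Lp / μ * ‖xh - xk‖ ^ p := by
  have hpow : ‖xh - xk‖ ^ (p - 1) * ‖xh - xk‖ = ‖xh - xk‖ ^ p := by
    rcases (norm_nonneg (xh - xk)).eq_or_lt with h | h
    · rw [← h, mul_zero, Real.zero_rpow (by linarith)]
    · rw [Real.rpow_sub_one h.ne']
      field_simp
  have hγ0 : 0 ≤ γ := by
    rw [hγ]
    positivity
  have h1 := hsmono xh hxh xstar hxstarX
  have h2 := hxstar xh hxh
  have h3 := hstep1 xstar hxstarX
  have hsplit : ⟪F xh - F xstar, xh - xstar⟫_ℝ =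
      ⟪(F xh - Ftil xh) - γ • (xh - xk), xh - xstar⟫_ℝ
        - ⟪Ftil xh + γ • (xh - xk), xstar - xh⟫_ℝ - ⟪F xstar, xh - xstar⟫_ℝ := by
    rw [← neg_sub xh xstar, inner_neg_right]
    simp only [inner_sub_left, inner_add_left]
    ring
  have h4 := real_inner_le_norm ((F xh - Ftil xh) - γ • (xh - xk)) (xh - xstar)
  have h5 : ‖(F xh - Ftil xh) - γ • (xh - xk)‖ ≤ (1 + τ) * Lp * ‖xh - xk‖ ^ p := by
    have ha := norm_sub_le (F xh - Ftil xh) (γ • (xh - xk))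
    have hb := happrox xh
    rw [norm_sub_rev] at hb
    have hc : ‖γ • (xh - xk)‖ = Lp * ‖xh - xk‖ ^ p := by
      rw [norm_smul, Real.norm_of_nonneg hγ0, hγ, mul_assoc, hpow]
    linarith
  have h6 := mul_le_mul_of_nonneg_right h5 (norm_nonneg (xh - xstar))
  have hR : 0 ≤ (1 + τ) * Lp * ‖xh - xk‖ ^ p := le_trans (norm_nonneg _) h5
  rw [div_mul_eq_mul_div, le_div_iff₀ hμ]
  rcases (norm_nonneg (xh - xstar)).eq_or_lt with h | h
  · rw [← h, zero_mul]
    exact hR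
  · refine le_of_mul_le_mul_right ?_ h
    nlinarith
end

section
/- Let X ⊆ ℝ^n be convex, F monotone on X, and x* ∈ X a solution of VI_X(F). Fix p ≥ 1 real, L_p > 0, τ ∈ (0,1), and points x^k, x^{k+0.5}, x^{k+1} ∈ X with γ_k := L_p‖x^{k+0.5} − x^k‖^{p−1}, satisfying the two ARE optimality conditions (i) ⟨F̃_k(x^{k+0.5}) + γ_k(x^{k+0.5} − x^k), x − x^{k+0.5}⟩ ≥ 0 for all x ∈ X and (ii) ⟨F(x^{k+0.5}) + γ_k(x^{k+1} − x^k), x − x^{k+1}⟩ ≥ 0 for all x ∈ X, together with the approximation bound ‖F̃_k(x) − F(x)‖ ≤ τ L_p‖x − x^k‖^p for all x. Then (1 − τ²)‖x^{k+0.5} − x^k‖² ≤ ‖x^k − x*‖². -/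
open scoped InnerProductSpace

/-- Bound (4.4): the step length is controlled by the distance to the solution. -/
theorem are_step_length_bound
    {n : ℕ} (X : Set (EuclideanSpace ℝ (Fin n))) (hX : Convex ℝ X)
    (F : EuclideanSpace ℝ (Fin n) → EuclideanSpace ℝ (Fin n))
    (hmono : ∀ x ∈ X, ∀ y ∈ X, 0 ≤ ⟪F x - F y, x - y⟫_ℝ)
    (xstar : EuclideanSpace ℝ (Fin n)) (hxstarX : xstar ∈ X)
    (hxstar : ∀ x ∈ X, 0 ≤ ⟪F xstar, x - xstar⟫_ℝ)
    (Ftil : EuclideanSpace ℝ (Fin n) → EuclideanSpace ℝ (Fin n))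
    (p Lp τ : ℝ) (hp : 1 ≤ p) (hLp : 0 < Lp) (hτ0 : 0 < τ) (hτ1 : τ < 1)
    (xk xh xkp1 : EuclideanSpace ℝ (Fin n))
    (hxk : xk ∈ X) (hxh : xh ∈ X) (hxkp1 : xkp1 ∈ X)
    (γ : ℝ) (hγ : γ = Lp * ‖xh - xk‖ ^ (p - 1))
    (hstep1 : ∀ z ∈ X, 0 ≤ ⟪Ftil xh + γ • (xh - xk), z - xh⟫_ℝ)
    (hstep2 : ∀ z ∈ X, 0 ≤ ⟪F xh + γ • (xkp1 - xk), z - xkp1⟫_ℝ)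
    (happrox : ∀ z, ‖Ftil z - F z‖ ≤ τ * Lp * ‖z - xk‖ ^ p) :
    (1 - τ ^ 2) * ‖xh - xk‖ ^ 2 ≤ ‖xk - xstar‖ ^ 2 := by
  by_cases h0 : xh - xk = 0
  · rw [h0]; simp
  have hd : 0 < ‖xh - xk‖ := norm_pos_iff.mpr h0
  have hγ0 : 0 < γ := by rw [hγ]; positivity
  have hpow : ‖xh - xk‖ ^ p = ‖xh - xk‖ ^ (p - 1) * ‖xh - xk‖ := by
    rw [← Real.rpow_add_one hd.ne']; congr 1; ring
  have h1 := hstep1 xkp1 hxkp1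
  have h2 := hstep2 xstar hxstarX
  have h3 := hmono xh hxh xstar hxstarX
  have h4 := hxstar xh hxh
  have h5 : ‖Ftil xh - F xh‖ ≤ γ * (τ * ‖xh - xk‖) := by
    refine (happrox xh).trans (le_of_eq ?_)
    rw [hpow, hγ]; ring
  obtain ⟨a, rfl⟩ : ∃ a, xh = xk + a := ⟨xh - xk, by abel⟩
  obtain ⟨b, rfl⟩ : ∃ b, xkp1 = xk + b := ⟨xkp1 - xk, by abel⟩
  obtain ⟨s, rfl⟩ : ∃ s, xstar = xk + s := ⟨xstar - xk, by abel⟩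
  have e1 : ‖xk - (xk + s)‖ = ‖s‖ := by
    rw [show xk - (xk + s) = -s by abel, norm_neg]
  rw [e1]
  simp only [add_sub_add_left_eq_sub, add_sub_cancel_left] at *
  have h6 : ⟪Ftil (xk + a) - F (xk + a), b - a⟫_ℝ ≤ γ * (τ * ‖a‖) * ‖b - a‖ :=
    (real_inner_le_norm _ _).trans (by gcongr)
  have h7 := norm_sub_sq_real b a
  have h8 := norm_sub_sq_real s b
  have h9 : 0 ≤ γ * (τ * ‖a‖ - ‖b - a‖) ^ 2 := by positivity
  have h10 : 0 ≤ γ * ‖s - b‖ ^ 2 := by positivity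
  simp only [inner_add_left, inner_sub_left, inner_sub_right, inner_smul_left,
    real_inner_self_eq_norm_sq, conj_trivial] at h1 h2 h3 h4 h6
  rw [real_inner_comm] at h7 h8
  refine le_of_mul_le_mul_left ?_ hγ0
  rw [h8] at h10
  have h11 : γ * ‖b - a‖ ^ 2 = γ * (‖b‖ ^ 2 - 2 * ⟪a, b⟫_ℝ + ‖a‖ ^ 2) := by rw [h7]
  nlinarith
end

section
/- (Local p-th order superlinear convergence of the regularized step.) Let X ⊆ ℝ^n be convex, F μ-strongly monotone on X with μ > 0, and x* ∈ X a solution of VI_X(F). Fix p ≥ 1 real, L_p > 0, τ ∈ (0,1), and points x^k, x^{k+0.5}, x^{k+1} ∈ X with γ_k := L_p‖x^{k+0.5} − x^k‖^{p−1}, satisfying the two ARE optimality conditions (i) ⟨F̃_k(x^{k+0.5}) + γ_k(x^{k+0.5} − x^k), x − x^{k+0.5}⟩ ≥ 0 for all x ∈ X and (ii) ⟨F(x^{k+0.5}) + γ_k(x^{k+1} − x^k), x − x^{k+1}⟩ ≥ 0 for all x ∈ X, together with the approximation bound ‖F̃_k(x) − F(x)‖ ≤ τ L_p‖x − x^k‖^p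 for all x. Then ‖x^{k+0.5} − x*‖ ≤ ((1 + τ) L_p / (μ (1 − τ²)^{p/2})) · ‖x^k − x*‖^p. -/
open scoped InnerProductSpace

/-- Local `p`-th order superlinear convergence (4.5) of the regularized step. -/
theorem are_local_superlinear_convergence
    {n : ℕ} (X : Set (EuclideanSpace ℝ (Fin n))) (hX : Convex ℝ X)
    (F : EuclideanSpace ℝ (Fin n) → EuclideanSpace ℝ (Fin n))
    (μ : ℝ) (hμ : 0 < μ)
    (hsmono : ∀ x ∈ X, ∀ y ∈ X, μ * ‖x - y‖ ^ 2 ≤ ⟪F x - F y, x - y⟫_ℝ)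
    (xstar : EuclideanSpace ℝ (Fin n)) (hxstarX : xstar ∈ X)
    (hxstar : ∀ x ∈ X, 0 ≤ ⟪F xstar, x - xstar⟫_ℝ)
    (Ftil : EuclideanSpace ℝ (Fin n) → EuclideanSpace ℝ (Fin n))
    (p Lp τ : ℝ) (hp : 1 ≤ p) (hLp : 0 < Lp) (hτ0 : 0 < τ) (hτ1 : τ < 1)
    (xk xh xkp1 : EuclideanSpace ℝ (Fin n))
    (hxk : xk ∈ X) (hxh : xh ∈ X) (hxkp1 : xkp1 ∈ X)
    (γ : ℝ) (hγ : γ = Lp * ‖xh - xk‖ ^ (p - 1))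
    (hstep1 : ∀ z ∈ X, 0 ≤ ⟪Ftil xh + γ • (xh - xk), z - xh⟫_ℝ)
    (hstep2 : ∀ z ∈ X, 0 ≤ ⟪F xh + γ • (xkp1 - xk), z - xkp1⟫_ℝ)
    (happrox : ∀ z, ‖Ftil z - F z‖ ≤ τ * Lp * ‖z - xk‖ ^ p) :
    ‖xh - xstar‖ ≤ (1 + τ) * Lp / (μ * (1 - τ ^ 2) ^ (p / 2)) * ‖xk - xstar‖ ^ p := by
  have hd : 0 ≤ ‖xh - xk‖ := norm_nonneg _
  have he : 0 ≤ ‖xh - xstar‖ := norm_nonneg _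
  have hD : 0 ≤ ‖xk - xstar‖ := norm_nonneg _
  have hγd : γ * ‖xh - xk‖ = Lp * ‖xh - xk‖ ^ p := by
    rw [hγ, mul_assoc]
    congr 1
    have h := Real.rpow_add_one' hd (y := p - 1) (by linarith)
    rw [← h]
    congr 1
    ring
  have h1 := hsmono xh hxh xstar hxstarX
  have h2 := hxstar xh hxh
  have h3 := hstep1 xstar hxstarX
  have h4 : -(τ * (γ * ‖xh - xk‖) * ‖xh - xstar‖) ≤ ⟪Ftil xh - F xh, xh - xstar⟫_ℝ := by
    have ha := abs_le.1 (abs_real_inner_le_norm (Ftil xh - F xh) (xh - xstar))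
    have hb := mul_le_mul_of_nonneg_right (happrox xh) he
    rw [hγd]
    nlinarith [ha.1]
  have h5 : -(‖xh - xk‖ * ‖xh - xstar‖) ≤ ⟪xh - xk, xh - xstar⟫_ℝ :=
    (abs_le.1 (abs_real_inner_le_norm (xh - xk) (xh - xstar))).1
  have hneg : xstar - xh = -(xh - xstar) := by abel
  rw [hneg, inner_neg_right, inner_add_left, real_inner_smul_left] at h3
  rw [inner_sub_left] at h1 h4
  have hγ0 : 0 ≤ γ := by rw [hγ]; positivity
  have key : μ * ‖xh - xstar‖ ^ 2 ≤
      γ * (-⟪xh - xk, xh - xstar⟫_ℝ + τ * ‖xh - xk‖ * ‖xh - xstar‖) := by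
    nlinarith
  have hDsq : (1 - τ ^ 2) * ‖xh - xk‖ ^ 2 ≤ ‖xk - xstar‖ ^ 2 := by
    rcases hd.eq_or_lt with h0 | h0
    · rw [← h0]; nlinarith [sq_nonneg ‖xk - xstar‖]
    · have hγp : 0 < γ := by rw [hγ]; positivity
      have hk : 0 ≤ -⟪xh - xk, xh - xstar⟫_ℝ + τ * ‖xh - xk‖ * ‖xh - xstar‖ := by
        have : 0 ≤ μ * ‖xh - xstar‖ ^ 2 := by positivity
        exact nonneg_of_mul_nonneg_right (this.trans key) hγp
      have hx : xk - xstar = (xh - xstar) - (xh - xk) := by abel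
      have hn := norm_sub_sq_real (xh - xstar) (xh - xk)
      rw [← hx, real_inner_comm] at hn
      nlinarith [sq_nonneg (‖xh - xstar‖ - τ * ‖xh - xk‖)]
  have ht : 0 < 1 - τ ^ 2 := by nlinarith
  have hc : 0 < (1 - τ ^ 2) ^ (p / 2) := Real.rpow_pos_of_pos ht _
  have hsq : ∀ a : ℝ, 0 ≤ a → (a ^ 2) ^ (p / 2) = a ^ p := by
    intro a ha
    rw [← Real.rpow_natCast, ← Real.rpow_mul ha]
    congr 1
    push_cast
    ring
  have hpow : (1 - τ ^ 2) ^ (p / 2) * ‖xh - xk‖ ^ p ≤ ‖xk - xstar‖ ^ p := by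
    have h := Real.rpow_le_rpow (by positivity) hDsq (by linarith : 0 ≤ p / 2)
    rwa [Real.mul_rpow ht.le (by positivity), hsq _ hd, hsq _ hD] at h
  have hlin : μ * ‖xh - xstar‖ ≤ (1 + τ) * Lp * ‖xh - xk‖ ^ p := by
    rcases he.eq_or_lt with h0 | h0
    · rw [← h0, mul_zero]; positivity
    · refine le_of_mul_le_mul_right ?_ h0
      have h6 := mul_le_mul_of_nonneg_left h5 hγ0
      have h7 : (1 + τ) * Lp * ‖xh - xk‖ ^ p = (1 + τ) * (γ * ‖xh - xk‖) := by
        rw [hγd]; ring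
      rw [h7]
      nlinarith
  rw [div_mul_eq_mul_div, le_div_iff₀ (by positivity)]
  have h8 := mul_le_mul_of_nonneg_right hlin hc.le
  have h9 := mul_le_mul_of_nonneg_left hpow (by positivity : 0 ≤ (1 + τ) * Lp)
  nlinarith
end

section
/- (Contraction of consecutive AR steps under the local acceptance condition.) Let X ⊆ ℝ^n be convex, F μ-strongly monotone on X with μ > 0, and x* ∈ X a solution of VI_X(F). Fix p ≥ 1 real, L_p > 0, τ ∈ (0,1), α ∈ (0,1), and points x^k, x^{k+1}, x^{k+2} ∈ X. Assume: (a) ⟨F̃_k(x^{k+1}) + L_p‖x^{k+1} − x^k‖^{p−1}(x^{k+1} − x^k), x − x^{k+1}⟩ ≥ 0 for all x ∈ X, where ‖F̃_k(x) − F(x)‖ ≤ τ L_p‖x − x^k‖^p for all x (so x^{k+1} is an AR update from x^k); (b) (1 − τ²)‖x^{k+2} − x^{k+1}‖² ≤ ‖x^{k+1} − x*‖²; and (c) ‖x^{k+1} − x^k‖^{p−1} ≤ (α √(1 − τ²)/(1 + τ)) · (μ/L_p). Then ‖x^{k+2} − x^{k+1}‖ ≤ α ‖x^{k+1} − x^k‖.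 -/
open scoped InnerProductSpace

/-- Contraction of consecutive AR steps under the local acceptance condition
(4.2) of Algorithm 1. -/
theorem ar_step_contraction
    {n : ℕ} (X : Set (EuclideanSpace ℝ (Fin n))) (hX : Convex ℝ X)
    (F : EuclideanSpace ℝ (Fin n) → EuclideanSpace ℝ (Fin n))
    (μ : ℝ) (hμ : 0 < μ)
    (hsmono : ∀ x ∈ X, ∀ y ∈ X, μ * ‖x - y‖ ^ 2 ≤ ⟪F x - F y, x - y⟫_ℝ)
    (xstar : EuclideanSpace ℝ (Fin n)) (hxstarX : xstar ∈ X)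
    (hxstar : ∀ x ∈ X, 0 ≤ ⟪F xstar, x - xstar⟫_ℝ)
    (Ftil : EuclideanSpace ℝ (Fin n) → EuclideanSpace ℝ (Fin n))
    (p Lp τ α : ℝ) (hp : 1 ≤ p) (hLp : 0 < Lp) (hτ0 : 0 < τ) (hτ1 : τ < 1)
    (hα0 : 0 < α) (hα1 : α < 1)
    (xk xkp1 xkp2 : EuclideanSpace ℝ (Fin n))
    (hxk : xk ∈ X) (hxkp1 : xkp1 ∈ X) (hxkp2 : xkp2 ∈ X)
    (hAR : ∀ z ∈ X,
      0 ≤ ⟪Ftil xkp1 + (Lp * ‖xkp1 - xk‖ ^ (p - 1)) • (xkp1 - xk), z - xkp1⟫_ℝ)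
    (happrox : ∀ z, ‖Ftil z - F z‖ ≤ τ * Lp * ‖z - xk‖ ^ p)
    (hb : (1 - τ ^ 2) * ‖xkp2 - xkp1‖ ^ 2 ≤ ‖xkp1 - xstar‖ ^ 2)
    (hc : ‖xkp1 - xk‖ ^ (p - 1) ≤ α * Real.sqrt (1 - τ ^ 2) / (1 + τ) * (μ / Lp)) :
    ‖xkp2 - xkp1‖ ≤ α * ‖xkp1 - xk‖ := by
  have hrp : ‖xkp1 - xk‖ ^ p = ‖xkp1 - xk‖ ^ (p - 1) * ‖xkp1 - xk‖ := by
    have h := Real.rpow_add_one' (norm_nonneg (xkp1 - xk)) (y := p - 1) (by linarith)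
    rwa [sub_add_cancel] at h
  have hA0 : 0 ≤ ‖xkp1 - xk‖ ^ (p - 1) := Real.rpow_nonneg (norm_nonneg _) _
  have h1 := hsmono xkp1 hxkp1 xstar hxstarX
  have h2 := hxstar xkp1 hxkp1
  have h3 := hAR xstar hxstarX
  have h4 := happrox xkp1
  rw [hrp] at h4
  generalize ‖xkp1 - xk‖ ^ (p - 1) = A at *
  have h5 : xstar - xkp1 = -(xkp1 - xstar) := by abel
  rw [h5, inner_neg_right, inner_add_left, real_inner_smul_left] at h3
  rw [inner_sub_left] at h1
  have h6 := real_inner_le_norm (F xkp1 - Ftil xkp1) (xkp1 - xstar)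
  rw [inner_sub_left, norm_sub_rev] at h6
  have h7 := neg_le_of_abs_le (abs_real_inner_le_norm (xkp1 - xk) (xkp1 - xstar))
  have hD := norm_nonneg (xkp1 - xstar)
  have hr := norm_nonneg (xkp1 - xk)
  have he := norm_nonneg (xkp2 - xkp1)
  generalize ‖xkp1 - xstar‖ = D at *
  generalize ‖xkp1 - xk‖ = r at *
  generalize ‖xkp2 - xkp1‖ = e at *
  have hS2 : 0 < 1 - τ ^ 2 := by nlinarith
  have hS := Real.sqrt_pos.mpr hS2
  have hSS := Real.sq_sqrt hS2.le
  generalize Real.sqrt (1 - τ ^ 2) = S at *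
  have h8 := mul_le_mul_of_nonneg_right h4 hD
  have h9 := mul_le_mul_of_nonneg_left h7 (mul_nonneg hLp.le hA0)
  have h10 : μ * D ^ 2 ≤ (1 + τ) * Lp * A * r * D := by nlinarith
  have h11 : (1 + τ) * Lp * A ≤ α * S * μ := by
    have := mul_le_mul_of_nonneg_left hc (by positivity : 0 ≤ (1 + τ) * Lp)
    have e1 : (1 + τ) * Lp * (α * S / (1 + τ) * (μ / Lp)) = α * S * μ := by
      field_simp
    linarith
  have h12 : D ≤ α * S * r := by
    rcases hD.eq_or_lt with h | h
    · rw [← h]; positivity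
    · have a1 := mul_le_mul_of_nonneg_right h11 (mul_nonneg hr hD)
      have a2 : (μ * D) * D ≤ (μ * D) * (α * S * r) := by nlinarith
      exact le_of_mul_le_mul_left a2 (by positivity)
  have h13 : S * e ≤ D := by
    refine (sq_le_sq₀ (by positivity) hD).mp ?_
    rw [mul_pow, hSS]; exact hb
  have h14 : S * e ≤ S * (α * r) := by linarith
  exact le_of_mul_le_mul_left h14 hS
end
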